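/- arXiv:1502.06258 — 5 statements merged into one kernel-verified Lean document; each statement's English description precedes it below -/
import Mathlib

section
/- Let $A$ be a commutative ring, let $L, D \in A$, and let $n \geq 1$ be an integer. Assume that $L^i \cdot D^{n-i} = 0$ in $A$ for every integer $i$ with $1 \leq i \leq n-1$. Then for every integer $k$ with $0 \leq k \leq n$ one has $(L - D)^k \cdot (2L - D)^{n-k} = 2^{n-k} \cdot L^n + (-1)^n \cdot D^n$. -/
section MixedProducts

variable {A : Type*} [CommRing A] {L D : A} {n : ℕ}

/-- If all mixed monomials of degree `n` in `L` and `D` vanish, so does every degree-`n` product of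
a mixed monomial with powers of two linear forms. -/
theorem mixed_mul_linear_pow_eq_zero
    (h : ∀ a b : ℕ, 1 ≤ a → 1 ≤ b → a + b = n → L ^ a * D ^ b = 0) (p q r s : A) (k l : ℕ) :
    ∀ a b : ℕ, 1 ≤ a → 1 ≤ b → a + b + k + l = n →
      L ^ a * D ^ b * ((p * L + q * D) ^ k * (r * L + s * D) ^ l) = 0 := by
  induction k with
  | zero =>
    induction l with
    | zero =>
      intro a b ha hb hab
      simpa using h a b ha hb hab
    | succ l ih =>
      intro a b ha hb hab
      linear_combination r * ih (a + 1) b (by lia) hb (by lia) +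
        s * ih a (b + 1) ha (by lia) (by lia)
  | succ k ih =>
    intro a b ha hb hab
    linear_combination p * ih (a + 1) b (by lia) hb (by lia) +
      q * ih a (b + 1) ha (by lia) (by lia)

/-- If all mixed monomials of degree `n` in `L` and `D` vanish, a degree-`n` product of a positive
power of `L` with powers of two linear forms only sees the coefficients of `L`. -/
theorem pow_mul_linear_pow
    (h : ∀ a b : ℕ, 1 ≤ a → 1 ≤ b → a + b = n → L ^ a * D ^ b = 0) (p q r s : A) (k l : ℕ) :
    ∀ a : ℕ, 1 ≤ a → a + k + l = n →
      L ^ a * ((p * L + q * D) ^ k * (r * L + s * D) ^ l) = p ^ k * r ^ l * L ^ n := by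
  induction k with
  | zero =>
    induction l with
    | zero =>
      intro a _ hab
      obtain rfl : a = n := by lia
      simp
    | succ l ih =>
      intro a ha hab
      linear_combination r * ih (a + 1) (by lia) (by lia) +
        s * mixed_mul_linear_pow_eq_zero h p q r s 0 l a 1 ha le_rfl (by lia)
  | succ k ih =>
    intro a ha hab
    linear_combination p * ih (a + 1) (by lia) (by lia) +
      q * mixed_mul_linear_pow_eq_zero h p q r s k l a 1 ha le_rfl (by lia)

/-- If all mixed monomials of degree `n ≥ 1` in `L` and `D` vanish, a degree-`n` product of powers
of two linear forms is the sum of its pure terms. -/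
theorem linear_pow_mul_linear_pow
    (h : ∀ a b : ℕ, 1 ≤ a → 1 ≤ b → a + b = n → L ^ a * D ^ b = 0) (hn : 1 ≤ n)
    (p q r s : A) (k l : ℕ) (hkl : k + l = n) :
    (p * L + q * D) ^ k * (r * L + s * D) ^ l =
      p ^ k * r ^ l * L ^ n + q ^ k * s ^ l * D ^ n := by
  have h' : ∀ a b : ℕ, 1 ≤ a → 1 ≤ b → a + b = n → D ^ a * L ^ b = 0 := fun a b ha hb hab ↦ by
    rw [mul_comm, h b a hb ha (by lia)]
  have swap (k l : ℕ) (hkl : 1 + k + l = n) :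
      D * ((p * L + q * D) ^ k * (r * L + s * D) ^ l) = q ^ k * s ^ l * D ^ n := by
    rw [← pow_mul_linear_pow h' q p s r k l 1 le_rfl hkl, pow_one, add_comm (p * L),
      add_comm (r * L)]
  cases k with
  | zero =>
    cases l with
    | zero => lia
    | succ l =>
      linear_combination r * pow_mul_linear_pow h p q r s 0 l 1 le_rfl (by lia) +
        s * swap 0 l (by lia)
  | succ k =>
    linear_combination p * pow_mul_linear_pow h p q r s k l 1 le_rfl (by lia) +
      q * swap k l (by lia)

end MixedProducts

theorem stmt_2 (A : Type*) [CommRing A] (L D : A) (n : ℕ) (hn : 1 ≤ n)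
    (h : ∀ i : ℕ, 1 ≤ i → i ≤ n - 1 → L ^ i * D ^ (n - i) = 0) :
    ∀ k : ℕ, k ≤ n →
      (L - D) ^ k * (2 * L - D) ^ (n - k) =
        2 ^ (n - k) * L ^ n + (-1 : A) ^ n * D ^ n := by
  intro k hk
  have mixed : ∀ a b : ℕ, 1 ≤ a → 1 ≤ b → a + b = n → L ^ a * D ^ b = 0 := fun a b ha hb hab ↦ by
    obtain rfl : b = n - a := by lia
    exact h a ha (by lia)
  have key := linear_pow_mul_linear_pow mixed hn 1 (-1) 2 (-1) k (n - k) (by lia)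
  rw [← pow_add, Nat.add_sub_cancel' hk] at key
  simpa [← sub_eq_add_neg] using key
end

section
/- Let $A$ be a commutative ring, let $f : A \to \mathbb{R}$ be an additive group homomorphism, let $L, D \in A$, let $n \geq 1$ be an integer, and let $q$ be a natural number. Assume: (i) $f(L^i \cdot D^{n-i}) = 0$ for every integer $i$ with $1 \leq i \leq n-1$; (ii) $q \leq f(D \cdot (2L - D)^{n-1})$; (iii) $0 \leq f((L - D)^n)$. Then $q \leq f(L^n)$. -/
theorem stmt_3 (A : Type*) [CommRing A] (f : A →+ ℝ) (L D : A) (n : ℕ) (hn : 1 ≤ n)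
    (q : ℕ)
    (h1 : ∀ i : ℕ, 1 ≤ i → i ≤ n - 1 → f (L ^ i * D ^ (n - i)) = 0)
    (h2 : (q : ℝ) ≤ f (D * (2 * L - D) ^ (n - 1)))
    (h3 : 0 ≤ f ((L - D) ^ n)) :
    (q : ℝ) ≤ f (L ^ n) := by
  obtain ⟨m, rfl⟩ := Nat.exists_eq_add_of_le' hn
  simp only [Nat.add_sub_cancel] at h1 h2
  have mixed_zero (c : ℤ) (k : ℕ) (hk : k < m) :
      f (c * (L ^ (k + 1) * D ^ (m + 1 - (k + 1)))) = 0 := by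
    rw [← zsmul_eq_mul, map_zsmul, h1 (k + 1) (by omega) (by omega), smul_zero]
  have boundary : f (D * (2 * L - D) ^ m) = -f ((-D) ^ (m + 1)) := by
    rw [sub_eq_add_neg, add_pow, Finset.sum_range_succ', mul_add, map_add, Finset.mul_sum,
      map_sum, Finset.sum_eq_zero, zero_add, ← map_neg]
    · congr 1
      simp [pow_succ, mul_comm]
    · intro k hk
      have hk : k < m := Finset.mem_range.mp hk
      rw [← mixed_zero (2 ^ (k + 1) * (-1) ^ (m - (k + 1)) * m.choose (k + 1)) k hk]
      congr 1
      obtain ⟨j, rfl⟩ := Nat.exists_eq_add_of_lt hk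
      rw [show k + j + 1 - (k + 1) = j by omega, show k + j + 1 + 1 - (k + 1) = j + 1 by omega,
        neg_pow D]
      push_cast
      ring
  have top : f ((L - D) ^ (m + 1)) = f (L ^ (m + 1)) + f ((-D) ^ (m + 1)) := by
    rw [sub_eq_add_neg, add_pow, Finset.sum_range_succ, Finset.sum_range_succ', map_add, map_add,
      map_sum, Finset.sum_eq_zero, zero_add, add_comm]
    · simp
    · intro k hk
      rw [← mixed_zero ((-1) ^ (m + 1 - (k + 1)) * (m + 1).choose (k + 1)) k
        (Finset.mem_range.mp hk)]
      congr 1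
      rw [neg_pow D]
      push_cast
      ring
  linarith
end

section
/- Let $A$ be a commutative ring, let $f : A \to \mathbb{R}$ be an additive group homomorphism, let $n \geq 1$ be an integer, let $I$ be a finite index set, let $L \in A$ and let $(D_i)_{i \in I}$ be a family of elements of $A$, and set $D = \sum_{i \in I} D_i$. Assume: (i) $f(L^i \cdot D^{n-i}) = 0$ for every integer $i$ with $1 \leq i \leq n-1$; (ii) $1 \leq f(D_i \cdot (2L - D)^{n-1})$ for every $i \in I$; (iii) $0 \leq f((L - D)^n)$. Then the cardinality of $I$ satisfies $|I| \leq f(L^n)$. -/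
theorem map_intCast_mul_eq {A : Type*} [CommRing A] (f : A →+ ℝ) (c : ℤ) (a : A) :
    f ((c : A) * a) = c * f a := by
  rw [← zsmul_eq_mul, map_zsmul, zsmul_eq_mul]

/-- If the mixed terms `L ^ i * D ^ (m + 1 - i)` vanish under `f`, only the pure power of `D`
contributes to `D * (2 * L - D) ^ m`. -/
theorem map_mul_two_mul_sub_pow {A : Type*} [CommRing A] (f : A →+ ℝ) (m : ℕ) (L D : A)
    (h : ∀ i : ℕ, 1 ≤ i → i ≤ m → f (L ^ i * D ^ (m + 1 - i)) = 0) :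
    f (D * (2 * L - D) ^ m) = (-1) ^ m * f (D ^ (m + 1)) := by
  have key : ∀ k ∈ Finset.range (m + 1),
      f (D * ((2 * L) ^ k * (-D) ^ (m - k) * (m.choose k : A))) =
        ((2 ^ k * (-1) ^ (m - k) * m.choose k : ℤ) : ℝ) * f (L ^ k * D ^ (m + 1 - k)) := by
    intro k hk
    have hkm : m + 1 - k = m - k + 1 := by have := Finset.mem_range.mp hk; omega
    rw [← map_intCast_mul_eq, hkm, neg_pow D]
    congr 1
    push_cast
    ring
  rw [sub_eq_add_neg, add_pow, Finset.mul_sum, map_sum, Finset.sum_congr rfl key,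
    Finset.sum_eq_single_of_mem 0 (by simp)]
  · simp
  · intro k hk hk0
    rw [h k (by omega) (by have := Finset.mem_range.mp hk; omega), mul_zero]

/-- If the mixed terms `L ^ i * D ^ (m + 1 - i)` vanish under `f`, only the pure powers
contribute to `(L - D) ^ (m + 1)`. -/
theorem map_sub_pow_succ {A : Type*} [CommRing A] (f : A →+ ℝ) (m : ℕ) (L D : A)
    (h : ∀ i : ℕ, 1 ≤ i → i ≤ m → f (L ^ i * D ^ (m + 1 - i)) = 0) :
    f ((L - D) ^ (m + 1)) = f (L ^ (m + 1)) + (-1) ^ (m + 1) * f (D ^ (m + 1)) := by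
  have key : ∀ k ∈ Finset.range (m + 1 + 1),
      f (L ^ k * (-D) ^ (m + 1 - k) * ((m + 1).choose k : A)) =
        (((-1) ^ (m + 1 - k) * (m + 1).choose k : ℤ) : ℝ) * f (L ^ k * D ^ (m + 1 - k)) := by
    intro k _
    rw [← map_intCast_mul_eq, neg_pow D]
    congr 1
    push_cast
    ring
  rw [sub_eq_add_neg, add_pow, map_sum, Finset.sum_congr rfl key, Finset.sum_range_succ,
    Finset.sum_eq_single_of_mem 0 (by simp)]
  · simp [add_comm]
  · intro k hk hk0
    rw [h k (by omega) (by have := Finset.mem_range.mp hk; omega), mul_zero]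

theorem stmt_4 (A : Type*) [CommRing A] (f : A →+ ℝ) (n : ℕ) (hn : 1 ≤ n)
    (I : Type*) [Fintype I] (L : A) (Di : I → A) (D : A) (hD : D = ∑ i, Di i)
    (h1 : ∀ i : ℕ, 1 ≤ i → i ≤ n - 1 → f (L ^ i * D ^ (n - i)) = 0)
    (h2 : ∀ i : I, 1 ≤ f (Di i * (2 * L - D) ^ (n - 1)))
    (h3 : 0 ≤ f ((L - D) ^ n)) :
    (Fintype.card I : ℝ) ≤ f (L ^ n) := by
  obtain ⟨m, rfl⟩ : ∃ m, n = m + 1 := ⟨n - 1, by omega⟩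
  rw [Nat.add_sub_cancel] at h1 h2
  have hcard : (Fintype.card I : ℝ) ≤ f (D * (2 * L - D) ^ m) := by
    calc (Fintype.card I : ℝ) = ∑ _i : I, (1 : ℝ) := by simp
      _ ≤ ∑ i, f (Di i * (2 * L - D) ^ m) := Finset.sum_le_sum fun i _ => h2 i
      _ = f (D * (2 * L - D) ^ m) := by
        rw [← map_sum, ← Finset.sum_mul, ← hD]
  rw [map_mul_two_mul_sub_pow f m L D h1] at hcard
  rw [map_sub_pow_succ f m L D h1, pow_succ (-1 : ℝ)] at h3
  linarith
end

section
/- Let $A$ be a commutative ring, let $f : A \to \mathbb{R}$ be an additive group homomorphism, let $n \geq 1$ be an integer, let $I$ be a nonempty finite index set, let $L \in A$, let $(D_i)_{i \in I}$ be a family of elements of $A$, and let $(r_i)_{i \in I}$ be a family of natural numbers with $r_i \geq 2$ for every $i$. Assume: (i) $L \cdot D_i = 0$ for every $i \in I$; (ii) $D_i \cdot D_j = 0$ for all $i \neq j$ in $I$; (iii) $(-1)^{n-1} f(D_i^n) > 0$ for every $i \in I$; (iv) $f\big((L - \sum_{i \in I} r_i D_i)^n\big) \geq 0$. Then $f\big((L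 - \sum_{i \in I} D_i)^n\big) > 0$. -/
theorem add_pow_succ_of_mul_eq_zero {R : Type*} [CommSemiring R] {a b : R} (h : a * b = 0)
    (m : ℕ) : (a + b) ^ (m + 1) = a ^ (m + 1) + b ^ (m + 1) := by
  induction m with
  | zero => simp
  | succ k ih =>
    rw [pow_succ, ih]
    have e : (a ^ (k + 1) + b ^ (k + 1)) * (a + b)
        = a ^ (k + 1 + 1) + b ^ (k + 1 + 1) + (a ^ k + b ^ k) * (a * b) := by ring
    rw [e, h, mul_zero, add_zero]

theorem sum_pow_succ_of_pairwise_mul_eq_zero {R ι : Type*} [CommSemiring R] (s : Finset ι)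
    {x : ι → R} (h : ∀ i j, i ≠ j → x i * x j = 0) (m : ℕ) :
    (∑ i ∈ s, x i) ^ (m + 1) = ∑ i ∈ s, x i ^ (m + 1) := by
  classical
  induction s using Finset.induction_on with
  | empty => simp
  | insert a s ha ih =>
    rw [Finset.sum_insert ha, Finset.sum_insert ha, add_pow_succ_of_mul_eq_zero, ih]
    rw [Finset.mul_sum]
    exact Finset.sum_eq_zero fun j hj => h a j fun e => ha (e ▸ hj)

theorem map_sub_sum_natCast_mul_pow_succ {A I : Type*} [CommRing A] [Fintype I] (f : A →+ ℝ)
    {L : A} {D : I → A} (hL : ∀ i, L * D i = 0) (hD : ∀ i j, i ≠ j → D i * D j = 0)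
    (c : I → ℕ) (m : ℕ) :
    f ((L - ∑ i, (c i : A) * D i) ^ (m + 1)) =
      f (L ^ (m + 1)) - ∑ i, (c i : ℝ) ^ (m + 1) * ((-1) ^ m * f (D i ^ (m + 1))) := by
  have hterm (i : I) : f ((-((c i : A) * D i)) ^ (m + 1)) =
      -((c i : ℝ) ^ (m + 1) * ((-1) ^ m * f (D i ^ (m + 1)))) := by
    have e : (-((c i : A) * D i)) ^ (m + 1) = ((-(c i : ℤ)) ^ (m + 1)) • D i ^ (m + 1) := by
      rw [zsmul_eq_mul, ← neg_mul, mul_pow]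
      push_cast
      rfl
    rw [e, map_zsmul, zsmul_eq_mul]
    push_cast
    rw [neg_pow]
    ring
  rw [sub_eq_add_neg, ← Finset.sum_neg_distrib, add_pow_succ_of_mul_eq_zero,
    sum_pow_succ_of_pairwise_mul_eq_zero, map_add, map_sum, Finset.sum_congr rfl fun i _ => hterm i,
    Finset.sum_neg_distrib, sub_eq_add_neg]
  · intro i j hij
    linear_combination (c i : A) * c j * hD i j hij
  · rw [Finset.mul_sum]
    refine Finset.sum_eq_zero fun i _ => ?_
    linear_combination -(c i : A) * hL i

theorem stmt_7 (A : Type*) [CommRing A] (f : A →+ ℝ) (n : ℕ) (hn : 1 ≤ n)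
    (I : Type*) [Fintype I] [Nonempty I] (L : A) (Di : I → A) (r : I → ℕ)
    (hr : ∀ i : I, 2 ≤ r i)
    (h1 : ∀ i : I, L * Di i = 0)
    (h2 : ∀ i j : I, i ≠ j → Di i * Di j = 0)
    (h3 : ∀ i : I, 0 < (-1 : ℝ) ^ (n - 1) * f (Di i ^ n))
    (h4 : 0 ≤ f ((L - ∑ i, (r i : A) * Di i) ^ n)) :
    0 < f ((L - ∑ i, Di i) ^ n) := by
  obtain ⟨m, rfl⟩ := Nat.exists_eq_add_of_le' hn
  simp only [Nat.add_sub_cancel] at h3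
  rw [map_sub_sum_natCast_mul_pow_succ f h1 h2] at h4
  have key := map_sub_sum_natCast_mul_pow_succ f h1 h2 (fun _ => 1) m
  simp only [Nat.cast_one, one_mul, one_pow] at key
  have hlt : ∑ i, (-1 : ℝ) ^ m * f (Di i ^ (m + 1)) <
      ∑ i, (r i : ℝ) ^ (m + 1) * ((-1) ^ m * f (Di i ^ (m + 1))) := by
    refine Finset.sum_lt_sum_of_nonempty Finset.univ_nonempty fun i _ => ?_
    have hri : (1 : ℝ) < r i := by exact_mod_cast hr i
    exact lt_mul_of_one_lt_left (h3 i) (one_lt_pow₀ hri m.succ_ne_zero)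
  rw [key]
  linarith
end

section
/- Let $A$ be a commutative ring, let $f : A \to \mathbb{R}$ be an additive group homomorphism, let $L, D \in A$, and let $n \geq 1$ be an integer. Assume: (i) $f(L^i \cdot D^{n-i}) = 0$ for every integer $i$ with $1 \leq i \leq n-1$; (ii) $f(L^n) > 0$; (iii) $f(L^n) + (-1)^n f(D^n) \geq 0$. Then for every integer $k$ with $0 \leq k \leq n-1$ one has $f\big((L - D)^k \cdot (2L - D)^{n-k}\big) \geq (2^{n-k} - 1) \, f(L^n) > 0$. -/
section MixedVanishing

variable {A : Type*} [CommRing A] (f : A →+ ℝ) {L D : A} {n : ℕ}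

theorem map_pow_mul_pow_mul_sub_pow_eq_zero
    (h : ∀ i : ℕ, 1 ≤ i → i ≤ n - 1 → f (L ^ i * D ^ (n - i)) = 0) (j : ℕ) :
    ∀ i l : ℕ, 1 ≤ i → 1 ≤ l → i + l + j = n → f (L ^ i * D ^ l * (L - D) ^ j) = 0 := by
  induction j with
  | zero =>
    intro i l hi hl hn
    have := h i hi (by omega)
    rw [show n - i = l by omega] at this
    simpa using this
  | succ j ih =>
    intro i l hi hl hn
    rw [show L ^ i * D ^ l * (L - D) ^ (j + 1) =
      L ^ (i + 1) * D ^ l * (L - D) ^ j - L ^ i * D ^ (l + 1) * (L - D) ^ j by ring,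
      map_sub, ih _ _ (by omega) hl (by omega), ih _ _ hi (by omega) (by omega), sub_zero]

theorem map_pow_mul_sub_pow
    (h : ∀ i : ℕ, 1 ≤ i → i ≤ n - 1 → f (L ^ i * D ^ (n - i)) = 0) (j : ℕ) :
    ∀ i : ℕ, 1 ≤ i → i + j = n → f (L ^ i * (L - D) ^ j) = f (L ^ n) := by
  induction j with
  | zero =>
    rintro i - rfl
    simp
  | succ j ih =>
    intro i hi hn
    rw [show L ^ i * (L - D) ^ (j + 1) =
      L ^ (i + 1) * (L - D) ^ j - L ^ i * D ^ 1 * (L - D) ^ j by ring,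
      map_sub, ih _ (by omega) (by omega),
      map_pow_mul_pow_mul_sub_pow_eq_zero f h j i 1 hi le_rfl (by omega), sub_zero]

theorem map_boundary_pow_mul_sub_pow
    (h : ∀ i : ℕ, 1 ≤ i → i ≤ n - 1 → f (L ^ i * D ^ (n - i)) = 0) (j : ℕ) :
    ∀ l : ℕ, 1 ≤ l → l + j = n → f (D ^ l * (L - D) ^ j) = (-1) ^ j * f (D ^ n) := by
  induction j with
  | zero =>
    rintro l - rfl
    simp
  | succ j ih =>
    intro l hl hn
    rw [show D ^ l * (L - D) ^ (j + 1) =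
      L ^ 1 * D ^ l * (L - D) ^ j - D ^ (l + 1) * (L - D) ^ j by ring,
      map_sub, ih _ (by omega) (by omega),
      map_pow_mul_pow_mul_sub_pow_eq_zero f h j 1 l le_rfl hl (by omega)]
    ring

theorem map_sub_pow (hn : 1 ≤ n)
    (h : ∀ i : ℕ, 1 ≤ i → i ≤ n - 1 → f (L ^ i * D ^ (n - i)) = 0) :
    f ((L - D) ^ n) = f (L ^ n) + (-1) ^ n * f (D ^ n) := by
  obtain ⟨j, rfl⟩ := Nat.exists_eq_add_of_le' hn
  rw [show (L - D) ^ (j + 1) = L ^ 1 * (L - D) ^ j - D ^ 1 * (L - D) ^ j by ring,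
    map_sub, map_pow_mul_sub_pow f h j 1 le_rfl (by omega),
    map_boundary_pow_mul_sub_pow f h j 1 le_rfl (by omega)]
  ring

theorem map_pow_mul_sub_pow_mul_two_mul_sub_pow
    (h : ∀ i : ℕ, 1 ≤ i → i ≤ n - 1 → f (L ^ i * D ^ (n - i)) = 0) (m : ℕ) :
    ∀ i k : ℕ, 1 ≤ i → i + k + m = n →
      f (L ^ i * (L - D) ^ k * (2 * L - D) ^ m) = 2 ^ m * f (L ^ n) := by
  induction m with
  | zero =>
    intro i k hi hn
    simpa using map_pow_mul_sub_pow f h k i hi hn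
  | succ m ih =>
    intro i k hi hn
    rw [show L ^ i * (L - D) ^ k * (2 * L - D) ^ (m + 1) =
      L ^ (i + 1) * (L - D) ^ k * (2 * L - D) ^ m +
        L ^ i * (L - D) ^ (k + 1) * (2 * L - D) ^ m by ring,
      map_add, ih _ _ (by omega) (by omega), ih _ _ hi (by omega)]
    ring

theorem map_sub_pow_mul_two_mul_sub_pow
    (h : ∀ i : ℕ, 1 ≤ i → i ≤ n - 1 → f (L ^ i * D ^ (n - i)) = 0) (m : ℕ) :
    ∀ k : ℕ, k + m = n →
      f ((L - D) ^ k * (2 * L - D) ^ m) = (2 ^ m - 1) * f (L ^ n) + f ((L - D) ^ n) := by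
  induction m with
  | zero =>
    rintro k rfl
    simp
  | succ m ih =>
    intro k hn
    rw [show (L - D) ^ k * (2 * L - D) ^ (m + 1) =
      L ^ 1 * (L - D) ^ k * (2 * L - D) ^ m + (L - D) ^ (k + 1) * (2 * L - D) ^ m by ring,
      map_add, ih _ (by omega),
      map_pow_mul_sub_pow_mul_two_mul_sub_pow f h m 1 k le_rfl (by omega)]
    ring

end MixedVanishing

theorem stmt_8 (A : Type*) [CommRing A] (f : A →+ ℝ) (L D : A) (n : ℕ) (hn : 1 ≤ n)
    (h1 : ∀ i : ℕ, 1 ≤ i → i ≤ n - 1 → f (L ^ i * D ^ (n - i)) = 0)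
    (h2 : 0 < f (L ^ n))
    (h3 : 0 ≤ f (L ^ n) + (-1 : ℝ) ^ n * f (D ^ n)) :
    ∀ k : ℕ, k ≤ n - 1 →
      ((2 : ℝ) ^ (n - k) - 1) * f (L ^ n) ≤ f ((L - D) ^ k * (2 * L - D) ^ (n - k)) ∧
      0 < ((2 : ℝ) ^ (n - k) - 1) * f (L ^ n) := by
  intro k hk
  constructor
  · rw [map_sub_pow_mul_two_mul_sub_pow f h1 (n - k) k (by omega), map_sub_pow f hn h1]
    linarith
  · exact mul_pos (sub_pos.2 (one_lt_pow₀ one_lt_two (by omega))) h2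
end
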